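/- arXiv:2010.00634 — 19 statements merged into one kernel-verified Lean document; each statement's English description precedes it below -/
import Mathlib

section
/- Let K be a field, n ≥ 1, and A an n×n matrix over K. For any two polynomials f, g ∈ K[X], with D = gcd(f, g) and M = lcm(f, g), one has rank f(A) + rank g(A) = rank D(A) + rank M(A). -/
theorem rank_aux_mem_range {K : Type*} [Field K] {n : ℕ}
    (A : Matrix (Fin n) (Fin n) K) (p : Polynomial K) (y : Fin n → K) :
    y ∈ LinearMap.range (Polynomial.aeval A p).mulVecLin ↔
      ∃ x, (Polynomial.aeval A p).mulVec x = y := by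
  simp [LinearMap.mem_range]

theorem rank_aux_range_le {K : Type*} [Field K] {n : ℕ}
    (A : Matrix (Fin n) (Fin n) K) (p q : Polynomial K) (h : p ∣ q) :
    LinearMap.range (Polynomial.aeval A q).mulVecLin ≤
      LinearMap.range (Polynomial.aeval A p).mulVecLin := by
  obtain ⟨r, rfl⟩ := h
  intro y hy
  rw [rank_aux_mem_range] at hy ⊢
  obtain ⟨x, rfl⟩ := hy
  exact ⟨(Polynomial.aeval A r).mulVec x, by rw [Matrix.mulVec_mulVec, map_mul]⟩

theorem rank_aux_data {K : Type*} [Field K] [DecidableEq K] (f g : Polynomial K)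
    (h : gcd f g ≠ 0) :
    ∃ p q a b : Polynomial K, gcd f g = p * f + q * g ∧ f = gcd f g * a ∧ g = gcd f g * b ∧
      p * a + q * b = 1 ∧ lcm f g ∣ gcd f g * a * b := by
  obtain ⟨a, ha⟩ := gcd_dvd_left f g
  obtain ⟨b, hb⟩ := gcd_dvd_right f g
  obtain ⟨p, q, hpq⟩ : ∃ p q, p * f + q * g = gcd f g := by
    have h1 : gcd f g ∈ Ideal.span {f, g} := by
      rw [← span_gcd]
      exact Ideal.mem_span_singleton_self _
    exact Ideal.mem_span_pair.1 h1
  refine ⟨p, q, a, b, hpq.symm, ha, hb, ?_, ?_⟩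
  · apply mul_left_cancel₀ h
    generalize gcd f g = d at *
    subst ha hb
    linear_combination hpq
  · apply lcm_dvd
    · exact ⟨b, by rw [← ha]⟩
    · exact ⟨a, by rw [mul_right_comm, ← hb]⟩

theorem rank_aeval_add_rank_aeval_eq_rank_gcd_add_rank_lcm
    {K : Type*} [Field K] [DecidableEq K] {n : ℕ} (hn : 1 ≤ n)
    (A : Matrix (Fin n) (Fin n) K) (f g : Polynomial K) :
    (Polynomial.aeval A f).rank + (Polynomial.aeval A g).rank =
      (Polynomial.aeval A (gcd f g)).rank + (Polynomial.aeval A (lcm f g)).rank := by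
  by_cases h : gcd f g = 0
  · obtain ⟨rfl, rfl⟩ := (gcd_eq_zero_iff f g).1 h
    rw [h, lcm_zero_left]
  obtain ⟨p, q, a, b, hd, hf, hg, h1, hl⟩ := rank_aux_data f g h
  have hsup : LinearMap.range (Polynomial.aeval A f).mulVecLin ⊔
      LinearMap.range (Polynomial.aeval A g).mulVecLin =
      LinearMap.range (Polynomial.aeval A (gcd f g)).mulVecLin := by
    apply le_antisymm
    · exact sup_le (rank_aux_range_le A _ _ (gcd_dvd_left f g))
        (rank_aux_range_le A _ _ (gcd_dvd_right f g))
    · intro y hy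
      rw [rank_aux_mem_range] at hy
      obtain ⟨x, rfl⟩ := hy
      rw [hd, map_add, Matrix.add_mulVec]
      apply Submodule.add_mem_sup
      · exact rank_aux_range_le A f (p * f) (dvd_mul_left _ _)
          ((rank_aux_mem_range _ _ _).2 ⟨x, rfl⟩)
      · exact rank_aux_range_le A g (q * g) (dvd_mul_left _ _)
          ((rank_aux_mem_range _ _ _).2 ⟨x, rfl⟩)
  have hinf : LinearMap.range (Polynomial.aeval A f).mulVecLin ⊓
      LinearMap.range (Polynomial.aeval A g).mulVecLin =
      LinearMap.range (Polynomial.aeval A (lcm f g)).mulVecLin := by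
    apply le_antisymm
    · rintro y ⟨hy1, hy2⟩
      obtain ⟨x, hx⟩ := (rank_aux_mem_range _ _ _).1 hy1
      obtain ⟨z, hz⟩ := (rank_aux_mem_range _ _ _).1 hy2
      have e : y = (Polynomial.aeval A (p * a * g)).mulVec z +
          (Polynomial.aeval A (q * b * f)).mulVec x := by
        rw [map_mul _ (p * a), map_mul _ (q * b), ← Matrix.mulVec_mulVec,
          ← Matrix.mulVec_mulVec, hx, hz, ← Matrix.add_mulVec, ← map_add, h1, map_one,
          Matrix.one_mulVec]
      rw [e]
      apply Submodule.add_mem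
      · refine rank_aux_range_le A _ _ (hl.trans ⟨p, ?_⟩)
          ((rank_aux_mem_range _ _ _).2 ⟨z, rfl⟩)
        linear_combination p * a * hg
      · refine rank_aux_range_le A _ _ (hl.trans ⟨q, ?_⟩)
          ((rank_aux_mem_range _ _ _).2 ⟨x, rfl⟩)
        linear_combination q * b * hf
    · exact le_inf (rank_aux_range_le A _ _ (dvd_lcm_left f g))
        (rank_aux_range_le A _ _ (dvd_lcm_right f g))
  unfold Matrix.rank
  rw [← hsup, ← hinf, Submodule.finrank_sup_add_finrank_inf_eq]
end

section
/- Let K be a field, n ≥ 1, A an n×n matrix over K, and f, g ∈ K[X] with D = gcd(f, g) and M = lcm(f, g). Then M(A) = 0 if and only if rank f(A) + rank g(A) = rank D(A). -/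
theorem range_le_of_dvd_aux {K : Type*} [Field K] {n : ℕ}
    (A : Matrix (Fin n) (Fin n) K) {p q : Polynomial K} (h : p ∣ q) :
    LinearMap.range (Polynomial.aeval A q).mulVecLin ≤
      LinearMap.range (Polynomial.aeval A p).mulVecLin := by
  obtain ⟨r, rfl⟩ := h
  rw [map_mul, Matrix.mulVecLin_mul]
  exact LinearMap.range_comp_le_range _ _

theorem aeval_lcm_eq_zero_iff_rank_add_rank_eq_rank_gcd
    {K : Type*} [Field K] [DecidableEq K] {n : ℕ} (hn : 1 ≤ n)
    (A : Matrix (Fin n) (Fin n) K) (f g : Polynomial K) :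
    Polynomial.aeval A (lcm f g) = 0 ↔
      (Polynomial.aeval A f).rank + (Polynomial.aeval A g).rank =
        (Polynomial.aeval A (gcd f g)).rank := by
  obtain ⟨f1, g1, hf, hg, hu⟩ := extract_gcd f g
  rw [gcd_isUnit_iff] at hu
  obtain ⟨u, v, huv⟩ := hu
  have hfM := dvd_lcm_left f g
  have hgM := dvd_lcm_right f g
  have hDf := gcd_dvd_left f g
  have hDg := gcd_dvd_right f g
  have hM : lcm f g ∣ gcd f g * f1 * g1 :=
    lcm_dvd ⟨g1, by rw [← hf]⟩ ⟨f1, by rw [mul_right_comm, ← hg]⟩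
  generalize lcm f g = M at *
  generalize gcd f g = D at *
  have hsup : LinearMap.range (Polynomial.aeval A f).mulVecLin ⊔
      LinearMap.range (Polynomial.aeval A g).mulVecLin =
      LinearMap.range (Polynomial.aeval A D).mulVecLin := by
    apply le_antisymm
    · exact sup_le (range_le_of_dvd_aux A hDf) (range_le_of_dvd_aux A hDg)
    · rintro _ ⟨x, rfl⟩
      have e : D = f * u + g * v := by
        rw [hf, hg]; linear_combination (-D) * huv
      rw [e, map_add, map_mul, map_mul, Matrix.mulVecLin_add, Matrix.mulVecLin_mul,
        Matrix.mulVecLin_mul]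
      exact Submodule.add_mem_sup ⟨_, rfl⟩ ⟨_, rfl⟩
  have hinf : LinearMap.range (Polynomial.aeval A f).mulVecLin ⊓
      LinearMap.range (Polynomial.aeval A g).mulVecLin =
      LinearMap.range (Polynomial.aeval A M).mulVecLin := by
    apply le_antisymm
    · refine le_trans ?_ (range_le_of_dvd_aux A hM)
      rintro x ⟨⟨y, hy⟩, ⟨z, hz⟩⟩
      simp only [Matrix.mulVecLin_apply] at hy hz
      refine ⟨(Polynomial.aeval A u).mulVec z + (Polynomial.aeval A v).mulVec y, ?_⟩
      have e1 : D * f1 * g1 * u = (u * f1) * g := by rw [hg]; ring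
      have e2 : D * f1 * g1 * v = (v * g1) * f := by rw [hf]; ring
      rw [Matrix.mulVecLin_apply, Matrix.mulVec_add, Matrix.mulVec_mulVec, Matrix.mulVec_mulVec,
        ← map_mul, ← map_mul, e1, e2, map_mul _ (u * f1), map_mul _ (v * g1),
        ← Matrix.mulVec_mulVec, ← Matrix.mulVec_mulVec, hy, hz, ← Matrix.add_mulVec, ← map_add,
        huv, map_one, Matrix.one_mulVec]
    · exact le_inf (range_le_of_dvd_aux A hfM) (range_le_of_dvd_aux A hgM)
  have key := Submodule.finrank_sup_add_finrank_inf_eq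
    (LinearMap.range (Polynomial.aeval A f).mulVecLin)
    (LinearMap.range (Polynomial.aeval A g).mulVecLin)
  rw [hsup, hinf] at key
  have h0 : Polynomial.aeval A M = 0 ↔ (Polynomial.aeval A M).rank = 0 := by
    constructor
    · intro h; rw [h, Matrix.rank_zero]
    · intro h
      have h1 := Submodule.finrank_eq_zero.mp h
      rw [LinearMap.range_eq_bot] at h1
      exact Matrix.toLin'.injective (by rw [Matrix.toLin'_apply', h1, map_zero])
  rw [h0]
  unfold Matrix.rank
  omega
end

section
/- Let K be a field, n ≥ 1, A an n×n matrix over K, and f, g ∈ K[X] with D = gcd(f, g) and M = lcm(f, g). Let m_A ∈ K[X] be the minimal polynomial of A. Then m_A divides M if and only if rank f(A) + rank g(A) = rank D(A). -/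
open Polynomial in
theorem range_inf_range_aeval_lcm_aux {K V : Type*} [Field K] [DecidableEq K] [AddCommGroup V]
    [Module K V] (T : Module.End K V) (f g : K[X]) :
    LinearMap.range (aeval T f) ⊔ LinearMap.range (aeval T g)
        = LinearMap.range (aeval T (gcd f g)) ∧
    LinearMap.range (aeval T f) ⊓ LinearMap.range (aeval T g)
        = LinearMap.range (aeval T (lcm f g)) := by
  have mono : ∀ p q : K[X], p ∣ q →
      LinearMap.range (aeval T q) ≤ LinearMap.range (aeval T p) := by
    rintro p q ⟨r, rfl⟩ _ ⟨x, rfl⟩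
    exact ⟨aeval T r x, by rw [map_mul]; rfl⟩
  obtain ⟨a, b, hab⟩ := exists_gcd_eq_mul_add_mul f g
  refine ⟨le_antisymm (sup_le (mono _ _ (gcd_dvd_left f g)) (mono _ _ (gcd_dvd_right f g))) ?_,
    le_antisymm ?_ (le_inf (mono _ _ (dvd_lcm_left f g)) (mono _ _ (dvd_lcm_right f g)))⟩
  · rintro _ ⟨x, rfl⟩
    rw [hab, map_add, LinearMap.add_apply]
    exact Submodule.add_mem_sup (mono f (f * a) ⟨a, rfl⟩ ⟨x, rfl⟩)
      (mono g (g * b) ⟨b, rfl⟩ ⟨x, rfl⟩)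
  · obtain ⟨f1, hf⟩ := gcd_dvd_left f g
    obtain ⟨g1, hg⟩ := gcd_dvd_right f g
    generalize hD : gcd f g = D at *
    by_cases h0 : D = 0
    · subst h0
      have hf0 : f = 0 := by rw [hf, zero_mul]
      rw [hf0]
      simp
    have hc : f1 * a + g1 * b = 1 := by
      apply mul_left_cancel₀ h0
      calc D * (f1 * a + g1 * b) = (D * f1) * a + (D * g1) * b := by ring
        _ = D * 1 := by rw [← hf, ← hg, ← hab, mul_one]
    have hM : lcm f g ∣ f1 * g :=
      lcm_dvd ⟨g1, by linear_combination f1 * hg - g1 * hf⟩ ⟨f1, mul_comm _ _⟩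
    have hM2 : lcm f g ∣ g1 * f :=
      lcm_dvd ⟨g1, mul_comm _ _⟩ ⟨f1, by linear_combination g1 * hf - f1 * hg⟩
    rintro x ⟨⟨u, hu⟩, ⟨v, hv⟩⟩
    have hx : x = aeval T (f1 * g * a) v + aeval T (g1 * f * b) u := by
      have h1 : aeval T (f1 * a + g1 * b) x = x := by rw [hc]; simp
      rw [← h1, map_add, LinearMap.add_apply]
      congr 1
      · rw [← hv, show f1 * g * a = f1 * a * g by ring, map_mul _ (f1 * a) g]; rfl
      · rw [← hu, show g1 * f * b = g1 * b * f by ring, map_mul _ (g1 * b) f]; rfl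
    rw [hx]
    exact add_mem (mono _ _ (hM.mul_right a) ⟨v, rfl⟩) (mono _ _ (hM2.mul_right b) ⟨u, rfl⟩)

theorem minpoly_dvd_lcm_iff_rank_add_rank_eq_rank_gcd
    {K : Type*} [Field K] [DecidableEq K] {n : ℕ} (hn : 1 ≤ n)
    (A : Matrix (Fin n) (Fin n) K) (f g : Polynomial K) :
    minpoly K A ∣ lcm f g ↔
      (Polynomial.aeval A f).rank + (Polynomial.aeval A g).rank =
        (Polynomial.aeval A (gcd f g)).rank := by
  have hr : ∀ p : Polynomial K, (Polynomial.aeval A p).rank =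
      Module.finrank K (LinearMap.range (Polynomial.aeval (Matrix.toLinAlgEquiv' A) p)) := by
    intro p
    rw [Polynomial.aeval_algHom_apply]
    rfl
  obtain ⟨h1, h2⟩ := range_inf_range_aeval_lcm_aux (Matrix.toLinAlgEquiv' A) f g
  have h3 := Submodule.finrank_sup_add_finrank_inf_eq
    (LinearMap.range (Polynomial.aeval (Matrix.toLinAlgEquiv' A) f))
    (LinearMap.range (Polynomial.aeval (Matrix.toLinAlgEquiv' A) g))
  rw [h1, h2] at h3
  rw [hr, hr, hr, ← h3, minpoly.dvd_iff, Nat.add_eq_left, Submodule.finrank_eq_zero,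
    LinearMap.range_eq_bot, Polynomial.aeval_algHom_apply,
    map_eq_zero_iff _ (Matrix.toLinAlgEquiv' (R := K) (n := Fin n)).injective]
end

section
/- Let K be a field and f, g ∈ K[X]. Then f and g are coprime (their greatest common divisor is a unit) if and only if for every positive integer n and every n×n matrix A over K one has rank(f(A)·g(A)) + n = rank f(A) + rank g(A). -/
theorem isCoprime_iff_forall_rank_mul_add_card_eq_rank_add_rank
    {K : Type*} [Field K] (f g : Polynomial K) :
    IsCoprime f g ↔
      ∀ (n : ℕ), 1 ≤ n → ∀ (A : Matrix (Fin n) (Fin n) K),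
        (Polynomial.aeval A f * Polynomial.aeval A g).rank + n =
          (Polynomial.aeval A f).rank + (Polynomial.aeval A g).rank := by
  constructor
  · intro h n _ A
    have key : ∀ p : Polynomial K, (Polynomial.aeval A p).rank +
        Module.finrank K (LinearMap.ker (Polynomial.aeval (Matrix.toLinAlgEquiv' A) p)) = n := by
      intro p
      have h1 : Polynomial.aeval (Matrix.toLinAlgEquiv' A) p =
          (Polynomial.aeval A p).mulVecLin := by
        rw [Polynomial.aeval_algHom_apply (Matrix.toLinAlgEquiv' (R := K) (n := Fin n))]
        rfl
      rw [h1, Matrix.rank, LinearMap.finrank_range_add_finrank_ker]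
      simp
    have hf := key f
    have hg := key g
    have hfg := key (f * g)
    rw [← Polynomial.sup_ker_aeval_eq_ker_aeval_mul_of_coprime _ h, map_mul] at hfg
    have hs := Submodule.finrank_sup_add_finrank_inf_eq
      (LinearMap.ker (Polynomial.aeval (Matrix.toLinAlgEquiv' A) f))
      (LinearMap.ker (Polynomial.aeval (Matrix.toLinAlgEquiv' A) g))
    rw [(Polynomial.disjoint_ker_aeval_of_isCoprime _ h).eq_bot, finrank_bot] at hs
    omega
  · intro h
    have main : ∀ p : Polynomial K, Irreducible p → p ∣ f → ¬ p ∣ g := by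
      intro p hp hpf hpg
      let B := AdjoinRoot.powerBasis hp.ne_zero
      have hz : ∀ q : Polynomial K, p ∣ q →
          Polynomial.aeval (Algebra.leftMulMatrix B.basis (AdjoinRoot.root p)) q = 0 := by
        intro q hq
        rw [Polynomial.aeval_algHom_apply, AdjoinRoot.aeval_eq, AdjoinRoot.mk_eq_zero.2 hq,
          map_zero]
      have hd : 1 ≤ B.dim := by
        have : B.dim = p.natDegree := AdjoinRoot.powerBasis_dim hp.ne_zero
        rw [this]
        exact hp.natDegree_pos
      have := h B.dim hd (Algebra.leftMulMatrix B.basis (AdjoinRoot.root p))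
      rw [hz f hpf, hz g hpg, mul_zero, Matrix.rank_zero] at this
      omega
    refine isCoprime_of_irreducible_dvd ?_ main
    rintro ⟨rfl, rfl⟩
    exact main Polynomial.X Polynomial.irreducible_X (dvd_zero _) (dvd_zero _)
end

section
/- Let K be a field, n ≥ 1, A an n×n matrix over K, and f, g ∈ K[X] coprime polynomials. Then f(A)·g(A) = 0 if and only if rank f(A) + rank g(A) = n. -/
theorem aeval_mul_eq_zero_iff_rank_add_rank_eq_card
    {K : Type*} [Field K] {n : ℕ} (hn : 1 ≤ n)
    (A : Matrix (Fin n) (Fin n) K) (f g : Polynomial K) (hfg : IsCoprime f g) :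
    Polynomial.aeval A f * Polynomial.aeval A g = 0 ↔
      (Polynomial.aeval A f).rank + (Polynomial.aeval A g).rank = n := by
  have key : ∀ p : Polynomial K, Matrix.toLin' (Polynomial.aeval A p)
      = Polynomial.aeval (Matrix.toLin' A) p := fun p =>
    (Polynomial.aeval_algHom_apply
      (Matrix.toLinAlgEquiv' : Matrix (Fin n) (Fin n) K ≃ₐ[K] _).toAlgHom A p).symm
  have hr : ∀ p : Polynomial K, (Polynomial.aeval A p).rank
      + Module.finrank K (LinearMap.ker (Polynomial.aeval (Matrix.toLin' A) p)) = n := by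
    intro p
    have h := LinearMap.finrank_range_add_finrank_ker (Polynomial.aeval (Matrix.toLin' A) p)
    rw [Module.finrank_fin_fun, ← key] at h
    rw [← key]
    exact h
  have hs := Submodule.finrank_sup_add_finrank_inf_eq
    (LinearMap.ker (Polynomial.aeval (Matrix.toLin' A) f))
    (LinearMap.ker (Polynomial.aeval (Matrix.toLin' A) g))
  rw [Polynomial.sup_ker_aeval_eq_ker_aeval_mul_of_coprime _ hfg,
    (Polynomial.disjoint_ker_aeval_of_isCoprime _ hfg).eq_bot, finrank_bot] at hs
  have h1 := hr f
  have h2 := hr g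
  have h3 := hr (f * g)
  rw [← map_mul]
  have h0 : Polynomial.aeval A (f * g) = 0 ↔ (Polynomial.aeval A (f * g)).rank = 0 := by
    constructor
    · intro h
      rw [h, Matrix.rank_zero]
    · intro h
      have h' : Module.finrank K
          (LinearMap.range (Matrix.toLin' (Polynomial.aeval A (f * g)))) = 0 := h
      rw [Submodule.finrank_eq_zero, LinearMap.range_eq_bot] at h'
      exact (LinearEquiv.map_eq_zero_iff _).1 h'
  rw [h0]
  omega
end

section
/- Let K be a field, n ≥ 1, and A an n×n matrix over K. Then A is idempotent (A² = A) if and only if rank A + rank(Iₙ − A) = n, where Iₙ is the n×n identity matrix. -/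
theorem isIdempotent_iff_rank_add_rank_sub_eq_card
    {K : Type*} [Field K] {n : ℕ} (hn : 1 ≤ n)
    (A : Matrix (Fin n) (Fin n) K) :
    A ^ 2 = A ↔ A.rank + (1 - A).rank = n := by
  have hle : LinearMap.ker A.mulVecLin ≤ LinearMap.range (1 - A).mulVecLin := by
    intro x hx
    have hx' : A.mulVec x = 0 := by simpa using hx
    refine ⟨x, ?_⟩
    simp [Matrix.sub_mulVec, hx']
  have hrn : A.rank + Module.finrank K (LinearMap.ker A.mulVecLin) = n := by
    have h := LinearMap.finrank_range_add_finrank_ker A.mulVecLin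
    simpa [Matrix.rank] using h
  have hg : (1 - A).rank = Module.finrank K (LinearMap.range (1 - A).mulVecLin) := rfl
  constructor
  · intro h
    have hge : LinearMap.range (1 - A).mulVecLin ≤ LinearMap.ker A.mulVecLin := by
      rintro _ ⟨y, rfl⟩
      have h0 : A * (1 - A) = 0 := by
        rw [mul_sub, mul_one, ← pow_two, h, sub_self]
      simp only [LinearMap.mem_ker, Matrix.mulVecLin_apply, Matrix.mulVec_mulVec, h0,
        Matrix.zero_mulVec]
    rw [hg, ← le_antisymm hle hge, hrn]
  · intro h
    have heq := Submodule.eq_of_le_of_finrank_eq hle (by omega)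
    have h0 : A * (1 - A) = 0 := by
      apply Matrix.mulVec_injective
      funext y
      have hy : (1 - A).mulVecLin y ∈ LinearMap.ker A.mulVecLin := by
        rw [heq]; exact ⟨y, rfl⟩
      simpa only [LinearMap.mem_ker, Matrix.mulVecLin_apply, Matrix.mulVec_mulVec,
        Matrix.zero_mulVec] using hy
    rw [mul_sub, mul_one, ← pow_two] at h0
    exact (sub_eq_zero.mp h0).symm
end

section
/- Let K be a field of characteristic different from 2, n ≥ 1, and A an n×n matrix over K. Then A is involutive (A² = Iₙ) if and only if rank(Iₙ − A) + rank(Iₙ + A) = n, where Iₙ is the n×n identity matrix. -/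
theorem isInvolutive_iff_rank_sub_add_rank_add_eq_card
    {K : Type*} [Field K] (hK : ringChar K ≠ 2) {n : ℕ} (hn : 1 ≤ n)
    (A : Matrix (Fin n) (Fin n) K) :
    A ^ 2 = 1 ↔ (1 - A).rank + (1 + A).rank = n := by
  have h2 : (2 : K) ≠ 0 := Ring.two_ne_zero hK
  have hsup : (1 - A).mulVecLin.range ⊔ (1 + A).mulVecLin.range = ⊤ := by
    rw [eq_top_iff]
    intro v _
    refine Submodule.mem_sup.2 ⟨_, ⟨(2 : K)⁻¹ • v, rfl⟩, _, ⟨(2 : K)⁻¹ • v, rfl⟩, ?_⟩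
    rw [Matrix.mulVecLin_apply, Matrix.mulVecLin_apply, Matrix.sub_mulVec, Matrix.add_mulVec,
      Matrix.one_mulVec, sub_add_add_cancel, ← add_smul]
    have : (2 : K)⁻¹ + 2⁻¹ = 1 := by field_simp; norm_num
    rw [this, one_smul]
  have hdim := Submodule.finrank_sup_add_finrank_inf_eq
    (1 - A).mulVecLin.range (1 + A).mulVecLin.range
  rw [hsup, finrank_top, Module.finrank_fin_fun] at hdim
  change _ = (1 - A).rank + (1 + A).rank at hdim
  constructor
  · intro h
    have h0 : (1 - A) * (1 + A) = 0 := by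
      have : (1 - A) * (1 + A) = 1 - A ^ 2 := by noncomm_ring
      rw [this, h, sub_self]
    have hle := Matrix.rank_add_rank_le_card_of_mul_eq_zero h0
    rw [Fintype.card_fin] at hle
    omega
  · intro h
    have hbot : (1 - A).mulVecLin.range ⊓ (1 + A).mulVecLin.range = ⊥ := by
      apply Submodule.finrank_eq_zero.1
      omega
    have hz : 1 - A ^ 2 = 0 := by
      apply Matrix.mulVec_injective
      funext v
      have hm : (1 - A ^ 2).mulVec v ∈
          (1 - A).mulVecLin.range ⊓ (1 + A).mulVecLin.range := by
        refine ⟨⟨(1 + A).mulVec v, ?_⟩, ⟨(1 - A).mulVec v, ?_⟩⟩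
        · rw [Matrix.mulVecLin_apply, Matrix.mulVec_mulVec]
          congr 1
          noncomm_ring
        · rw [Matrix.mulVecLin_apply, Matrix.mulVec_mulVec]
          congr 1
          noncomm_ring
      rw [hbot, Submodule.mem_bot] at hm
      rw [hm, Matrix.zero_mulVec]
    exact (sub_eq_zero.1 hz).symm
end

section
/- Let K be a field of characteristic different from 2, n ≥ 1, and A an n×n matrix over K. Then A is tripotent (A³ = A) if and only if rank A + rank(Iₙ − A²) = n. -/
theorem isTripotent_iff_rank_add_rank_one_sub_sq_eq_card
    {K : Type*} [Field K] (hK : ringChar K ≠ 2) {n : ℕ} (hn : 1 ≤ n)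
    (A : Matrix (Fin n) (Fin n) K) :
    A ^ 3 = A ↔ A.rank + (1 - A ^ 2).rank = n := by
  have hsup : LinearMap.range A.mulVecLin ⊔ LinearMap.range (1 - A ^ 2).mulVecLin = ⊤ := by
    rw [eq_top_iff]
    intro v _
    refine Submodule.mem_sup.2 ⟨_, ⟨A.mulVec v, rfl⟩, _, ⟨v, rfl⟩, ?_⟩
    simp [Matrix.sub_mulVec, pow_two]
  have hdim := Submodule.finrank_sup_add_finrank_inf_eq
    (LinearMap.range A.mulVecLin) (LinearMap.range (1 - A ^ 2).mulVecLin)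
  rw [hsup, finrank_top, Module.finrank_fin_fun] at hdim
  change _ = A.rank + (1 - A ^ 2).rank at hdim
  rw [← hdim, Nat.add_eq_left, Submodule.finrank_eq_zero]
  constructor
  · intro h
    rw [eq_bot_iff]
    rintro x ⟨⟨v, hv⟩, ⟨w, hw⟩⟩
    simp only [Matrix.mulVecLin_apply] at hv hw
    have h1 : A.mulVec x = 0 := by
      have : A * (1 - A ^ 2) = 0 := by
        rw [mul_sub, mul_one, ← pow_succ', h, sub_self]
      rw [← hw, Matrix.mulVec_mulVec, this, Matrix.zero_mulVec]
    have h2 : x = (A * A).mulVec x := by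
      rw [← hv, Matrix.mulVec_mulVec]
      congr 1
      rw [← pow_two, ← pow_succ, h]
    rw [Submodule.mem_bot, h2, ← Matrix.mulVec_mulVec, h1, Matrix.mulVec_zero]
  · intro h
    have h0 : A * (1 - A ^ 2) = 0 := by
      apply Matrix.mulVec_injective
      funext v
      have hm : (A * (1 - A ^ 2)).mulVec v ∈
          LinearMap.range A.mulVecLin ⊓ LinearMap.range (1 - A ^ 2).mulVecLin := by
        refine ⟨⟨(1 - A ^ 2).mulVec v, by simp⟩, ⟨A.mulVec v, ?_⟩⟩
        have hc : (1 - A ^ 2) * A = A * (1 - A ^ 2) := by noncomm_ring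
        rw [Matrix.mulVecLin_apply, Matrix.mulVec_mulVec, hc]
      rw [h, Submodule.mem_bot] at hm
      rw [hm, Matrix.zero_mulVec]
    rw [mul_sub, mul_one, ← pow_succ', sub_eq_zero] at h0
    exact h0.symm
end

section
/- Let K be a field of characteristic different from 2, n ≥ 1, and A an n×n matrix over K. Then A is tripotent (A³ = A) if and only if rank(Iₙ − A) + rank(A + A²) = n. -/
theorem isTripotent_iff_rank_one_sub_add_rank_add_sq_eq_card
    {K : Type*} [Field K] (hK : ringChar K ≠ 2) {n : ℕ} (hn : 1 ≤ n)
    (A : Matrix (Fin n) (Fin n) K) :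
    A ^ 3 = A ↔ (1 - A).rank + (A + A ^ 2).rank = n := by
  have h2 : (2 : K) ≠ 0 := Ring.two_ne_zero hK
  have hle : LinearMap.ker (1 - A).mulVecLin ≤ LinearMap.range (A + A ^ 2).mulVecLin := by
    intro v hv
    have hv' : v - A.mulVec v = 0 := by
      simpa [LinearMap.mem_ker, Matrix.sub_mulVec] using hv
    have hv1 : A.mulVec v = v := (sub_eq_zero.mp hv').symm
    refine ⟨(2 : K)⁻¹ • v, ?_⟩
    rw [Matrix.mulVecLin_apply, Matrix.mulVec_smul, Matrix.add_mulVec, pow_two,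
      ← Matrix.mulVec_mulVec, hv1, hv1, ← two_smul K v, smul_smul, inv_mul_cancel₀ h2, one_smul]
  have hrn : (1 - A).rank + Module.finrank K (LinearMap.ker (1 - A).mulVecLin) = n := by
    have := LinearMap.finrank_range_add_finrank_ker (1 - A).mulVecLin
    rwa [Module.finrank_fin_fun] at this
  have hmul : (1 - A) * (A + A ^ 2) = A - A ^ 3 := by noncomm_ring
  constructor
  · intro h
    have h0 : (1 - A) * (A + A ^ 2) = 0 := by rw [hmul, h, sub_self]
    have hge : LinearMap.range (A + A ^ 2).mulVecLin ≤ LinearMap.ker (1 - A).mulVecLin := by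
      rintro _ ⟨w, rfl⟩
      rw [LinearMap.mem_ker, Matrix.mulVecLin_apply, Matrix.mulVecLin_apply,
        Matrix.mulVec_mulVec, h0, Matrix.zero_mulVec]
    rw [le_antisymm hle hge] at hrn
    exact hrn
  · intro h
    have heq := Submodule.eq_of_le_of_finrank_eq hle
      (Nat.add_left_cancel (hrn.trans h.symm))
    have h0 : (1 - A) * (A + A ^ 2) = 0 := by
      apply Matrix.ext_of_mulVec_single
      intro i
      have hm : (A + A ^ 2).mulVecLin (Pi.single i 1) ∈ LinearMap.ker (1 - A).mulVecLin := by
        rw [heq]; exact ⟨_, rfl⟩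
      rw [LinearMap.mem_ker, Matrix.mulVecLin_apply, Matrix.mulVecLin_apply,
        Matrix.mulVec_mulVec] at hm
      rw [hm, Matrix.zero_mulVec]
    rw [hmul] at h0
    exact (sub_eq_zero.mp h0).symm
end

section
/- Let K be a field of characteristic different from 2, n ≥ 1, and A an n×n matrix over K. Then rank A + rank(Iₙ − A²) = n if and only if rank A + rank(Iₙ − A) + rank(Iₙ + A) = 2n. -/
theorem rank_add_rank_one_sub_sq_eq_card_iff_rank_add_rank_sub_add_rank_add_eq_two_mul
    {K : Type*} [Field K] (hK : ringChar K ≠ 2) {n : ℕ} (hn : 1 ≤ n)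
    (A : Matrix (Fin n) (Fin n) K) :
    A.rank + (1 - A ^ 2).rank = n ↔
      A.rank + (1 - A).rank + (1 + A).rank = 2 * n := by
  have h2 : (2 : K) ≠ 0 := Ring.two_ne_zero hK
  have rn (M : Matrix (Fin n) (Fin n) K) :
      M.rank + Module.finrank K (LinearMap.ker M.mulVecLin) = n := by
    have := LinearMap.finrank_range_add_finrank_ker M.mulVecLin
    simpa [Matrix.rank] using this
  have hinf : LinearMap.ker (1 - A).mulVecLin ⊓ LinearMap.ker (1 + A).mulVecLin = ⊥ := by
    rw [eq_bot_iff]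
    rintro v ⟨h, h'⟩
    simp only [SetLike.mem_coe, LinearMap.mem_ker, Matrix.mulVecLin_apply, Matrix.sub_mulVec,
      Matrix.add_mulVec, Matrix.one_mulVec] at h h'
    have h3 : (2 : K) • v = 0 := by
      rw [two_smul]
      calc v + v = (v - A.mulVec v) + (v + A.mulVec v) := by abel
        _ = 0 := by rw [h, h', add_zero]
    simpa [h2] using h3
  have hsup : LinearMap.ker (1 - A).mulVecLin ⊔ LinearMap.ker (1 + A).mulVecLin
      = LinearMap.ker (1 - A ^ 2).mulVecLin := by
    have e1 : 1 - A ^ 2 = (1 + A) * (1 - A) := by noncomm_ring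
    have e2 : 1 - A ^ 2 = (1 - A) * (1 + A) := by noncomm_ring
    apply le_antisymm
    · apply sup_le
      · rw [e1, Matrix.mulVecLin_mul]
        exact LinearMap.ker_le_ker_comp _ _
      · rw [e2, Matrix.mulVecLin_mul]
        exact LinearMap.ker_le_ker_comp _ _
    · intro v hv
      rw [LinearMap.mem_ker, Matrix.mulVecLin_apply] at hv
      have hd : v = (2 : K)⁻¹ • (1 + A).mulVec v + (2 : K)⁻¹ • (1 - A).mulVec v := by
        rw [← smul_add, ← Matrix.add_mulVec, eq_inv_smul_iff₀ h2, two_smul]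
        simp [Matrix.add_mulVec, Matrix.sub_mulVec]
      rw [hd]
      apply Submodule.add_mem_sup
      · apply Submodule.smul_mem
        rw [LinearMap.mem_ker, Matrix.mulVecLin_apply, Matrix.mulVec_mulVec, ← e2, hv]
      · apply Submodule.smul_mem
        rw [LinearMap.mem_ker, Matrix.mulVecLin_apply, Matrix.mulVec_mulVec, ← e1, hv]
  have key := Submodule.finrank_sup_add_finrank_inf_eq
    (LinearMap.ker (1 - A).mulVecLin) (LinearMap.ker (1 + A).mulVecLin)
  rw [hinf, hsup, finrank_bot] at key
  have a := rn (1 - A)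
  have b := rn (1 + A)
  have c := rn (1 - A ^ 2)
  omega
end

section
/- Let K be a field, n ≥ 1, A an n×n matrix over K with characteristic polynomial f_A, and suppose f_A = f₁·f₂·…·f_k is a factorization into k ≥ 1 polynomials f₁, …, f_k ∈ K[X] that are pairwise coprime. Then rank f₁(A) + rank f₂(A) + … + rank f_k(A) = (k − 1)·n. -/
theorem aux_finrank_ker {K V ι : Type*} [Field K] [AddCommGroup V] [Module K V]
    [FiniteDimensional K V] (T : V →ₗ[K] V) (f : ι → Polynomial K)
    (hcop : ∀ i j, i ≠ j → IsCoprime (f i) (f j)) (s : Finset ι) :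
    Module.finrank K (LinearMap.ker (Polynomial.aeval T (∏ i ∈ s, f i)))
      = ∑ i ∈ s, Module.finrank K (LinearMap.ker (Polynomial.aeval T (f i))) := by
  classical
  induction s using Finset.induction_on with
  | empty =>
    have : LinearMap.ker (1 : V →ₗ[K] V) = ⊥ := LinearMap.ker_id
    rw [Finset.prod_empty, Finset.sum_empty, map_one (Polynomial.aeval T), this, finrank_bot]
  | insert a s ha ih =>
    have hc : IsCoprime (f a) (∏ i ∈ s, f i) :=
      IsCoprime.prod_right fun i hi => hcop _ _ (fun h => ha (h ▸ hi))
    rw [Finset.prod_insert ha, Finset.sum_insert ha, ← ih,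
      ← Polynomial.sup_ker_aeval_eq_ker_aeval_mul_of_coprime T hc,
      ← Submodule.finrank_sup_add_finrank_inf_eq,
      (Polynomial.disjoint_ker_aeval_of_isCoprime T hc).eq_bot, finrank_bot, add_zero]

theorem sum_rank_aeval_of_pairwise_coprime_factorization_charpoly
    {K : Type*} [Field K] [DecidableEq K] {n : ℕ} (hn : 1 ≤ n)
    (A : Matrix (Fin n) (Fin n) K) {k : ℕ} (hk : 1 ≤ k)
    (f : Fin k → Polynomial K)
    (hcop : ∀ i j, i ≠ j → IsCoprime (f i) (f j))
    (hfac : A.charpoly = ∏ i, f i) :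
    ∑ i, (Polynomial.aeval A (f i)).rank = (k - 1) * n := by
  have hT : ∀ p : Polynomial K, Polynomial.aeval (Matrix.toLinAlgEquiv' A) p
      = Matrix.toLinAlgEquiv' (Polynomial.aeval A p) := fun p =>
    Polynomial.aeval_algHom_apply (Matrix.toLinAlgEquiv' (R := K) (n := Fin n)).toAlgHom A p
  have h := aux_finrank_ker (Matrix.toLinAlgEquiv' A) f hcop Finset.univ
  rw [← hfac, hT, Matrix.aeval_self_charpoly, map_zero, LinearMap.ker_zero, finrank_top,
    Module.finrank_fin_fun] at h
  have hr : ∀ i, (Polynomial.aeval A (f i)).rank + Module.finrank K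
      (LinearMap.ker (Polynomial.aeval (Matrix.toLinAlgEquiv' A) (f i))) = n := by
    intro i
    rw [hT]
    have := LinearMap.finrank_range_add_finrank_ker
      (Matrix.toLinAlgEquiv' (Polynomial.aeval A (f i)))
    rw [Module.finrank_fin_fun] at this
    exact this
  have hs := Finset.sum_congr (rfl : (Finset.univ : Finset (Fin k)) = Finset.univ)
    (fun i _ => hr i)
  rw [Finset.sum_add_distrib, ← h] at hs
  simp only [Finset.sum_const, Finset.card_univ, Fintype.card_fin, smul_eq_mul] at hs
  rw [Nat.sub_mul, one_mul]
  omega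
end

section
/- Let K be a field of characteristic different from 2, n ≥ 1, and A an n×n matrix over K. Then rank(A + A²) + rank(A − A²) = rank A + rank(A − A³). -/
theorem rank_add_sq_add_rank_sub_sq_eq_rank_add_rank_sub_cube
    {K : Type*} [Field K] (hK : ringChar K ≠ 2) {n : ℕ} (hn : 1 ≤ n)
    (A : Matrix (Fin n) (Fin n) K) :
    (A + A ^ 2).rank + (A - A ^ 2).rank = A.rank + (A - A ^ 3).rank := by
  have h2 : (2 : K) ≠ 0 := Ring.two_ne_zero hK
  have halve : ∀ (S : Submodule K (Fin n → K)) (v : Fin n → K), v + v ∈ S → v ∈ S := by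
    intro S v hv
    rw [← two_smul K v] at hv
    exact (S.smul_mem_iff h2).1 hv
  have hsup : LinearMap.range (A + A ^ 2).mulVecLin ⊔ LinearMap.range (A - A ^ 2).mulVecLin
      = LinearMap.range A.mulVecLin := by
    apply le_antisymm
    · refine sup_le ?_ ?_
      · rintro _ ⟨x, rfl⟩
        refine ⟨Matrix.mulVec (1 + A) x, ?_⟩
        simp only [Matrix.mulVecLin_apply, Matrix.mulVec_mulVec]
        congr 1
        noncomm_ring
      · rintro _ ⟨x, rfl⟩
        refine ⟨Matrix.mulVec (1 - A) x, ?_⟩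
        simp only [Matrix.mulVecLin_apply, Matrix.mulVec_mulVec]
        congr 1
        noncomm_ring
    · rintro _ ⟨x, rfl⟩
      apply halve
      have h : A.mulVecLin x + A.mulVecLin x
          = (A + A ^ 2).mulVecLin x + (A - A ^ 2).mulVecLin x := by
        simp only [Matrix.mulVecLin_apply, ← Matrix.add_mulVec]
        congr 1
        abel
      rw [h]
      exact Submodule.add_mem_sup ⟨x, rfl⟩ ⟨x, rfl⟩
  have hinf : LinearMap.range (A + A ^ 2).mulVecLin ⊓ LinearMap.range (A - A ^ 2).mulVecLin
      = LinearMap.range (A - A ^ 3).mulVecLin := by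
    apply le_antisymm
    · rintro v ⟨⟨x, hx⟩, ⟨y, hy⟩⟩
      apply halve
      refine ⟨x + y, ?_⟩
      simp only [Matrix.mulVecLin_apply] at hx hy ⊢
      have e1 : Matrix.mulVec (A - A ^ 3) x = Matrix.mulVec (1 - A) v := by
        rw [← hx, Matrix.mulVec_mulVec]
        congr 1
        noncomm_ring
      have e2 : Matrix.mulVec (A - A ^ 3) y = Matrix.mulVec (1 + A) v := by
        rw [← hy, Matrix.mulVec_mulVec]
        congr 1
        noncomm_ring
      rw [Matrix.mulVec_add, e1, e2, Matrix.sub_mulVec, Matrix.add_mulVec, Matrix.one_mulVec]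
      abel
    · rintro _ ⟨x, rfl⟩
      refine ⟨⟨Matrix.mulVec (1 - A) x, ?_⟩, ⟨Matrix.mulVec (1 + A) x, ?_⟩⟩
      · simp only [Matrix.mulVecLin_apply, Matrix.mulVec_mulVec]
        congr 1
        noncomm_ring
      · simp only [Matrix.mulVecLin_apply, Matrix.mulVec_mulVec]
        congr 1
        noncomm_ring
  have h := Submodule.finrank_sup_add_finrank_inf_eq
    (LinearMap.range (A + A ^ 2).mulVecLin) (LinearMap.range (A - A ^ 2).mulVecLin)
  rw [hsup, hinf] at h
  exact h.symm
end

section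
/- Let K be a field, n ≥ 1, and A an n×n matrix over K. Then A³ = A⁵ if and only if rank A³ + rank(Iₙ − A²) = n. -/
theorem pow_three_eq_pow_five_iff_rank_cube_add_rank_one_sub_sq_eq_card
    {K : Type*} [Field K] {n : ℕ} (hn : 1 ≤ n)
    (A : Matrix (Fin n) (Fin n) K) :
    A ^ 3 = A ^ 5 ↔ (A ^ 3).rank + (1 - A ^ 2).rank = n := by
  have hle : LinearMap.ker (1 - A ^ 2).mulVecLin ≤ LinearMap.range (A ^ 3).mulVecLin := by
    intro v hv
    rw [LinearMap.mem_ker, Matrix.mulVecLin_apply, Matrix.sub_mulVec, Matrix.one_mulVec,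
      sub_eq_zero] at hv
    refine ⟨A.mulVec v, ?_⟩
    rw [Matrix.mulVecLin_apply, Matrix.mulVec_mulVec, ← pow_succ,
      show A ^ (3 + 1) = A ^ 2 * A ^ 2 by rw [← pow_add], ← Matrix.mulVec_mulVec, ← hv, ← hv]
  have hmul : (1 - A ^ 2) * A ^ 3 = A ^ 3 - A ^ 5 := by
    rw [sub_mul, one_mul, ← pow_add]
  have hrn := LinearMap.finrank_range_add_finrank_ker (1 - A ^ 2).mulVecLin
  rw [Module.finrank_fin_fun] at hrn
  have hmono := Submodule.finrank_mono hle
  constructor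
  · intro h
    have := Matrix.rank_add_rank_le_card_of_mul_eq_zero (hmul.trans (sub_eq_zero.2 h))
    rw [Fintype.card_fin] at this
    unfold Matrix.rank at *
    omega
  · intro h
    unfold Matrix.rank at h
    have heq := Submodule.eq_of_le_of_finrank_eq hle (by omega)
    rw [← sub_eq_zero, ← hmul]
    apply Matrix.ext_of_mulVec_single
    intro i
    have hm : (A ^ 3).mulVecLin (Pi.single i 1) ∈ LinearMap.ker (1 - A ^ 2).mulVecLin := by
      rw [heq]; exact LinearMap.mem_range_self _ _
    rw [LinearMap.mem_ker, Matrix.mulVecLin_apply, Matrix.mulVecLin_apply,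
      Matrix.mulVec_mulVec] at hm
    rw [hm, Matrix.zero_mulVec]
end

section
/- Let K be a field of characteristic different from 2, n ≥ 1, and A an n×n matrix over K. Then A³ = A⁵ if and only if rank(Iₙ − A) + rank(A³ + A⁴) = n. -/
theorem pow_three_eq_pow_five_iff_rank_one_sub_add_rank_cube_add_pow_four_eq_card
    {K : Type*} [Field K] (hK : ringChar K ≠ 2) {n : ℕ} (hn : 1 ≤ n)
    (A : Matrix (Fin n) (Fin n) K) :
    A ^ 3 = A ^ 5 ↔ (1 - A).rank + (A ^ 3 + A ^ 4).rank = n := by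
  have h2 : (2 : K) ≠ 0 := Ring.two_ne_zero hK
  have hPQ : (1 - A) * (A ^ 3 + A ^ 4) = A ^ 3 - A ^ 5 := by noncomm_ring
  have hdim := (1 - A).mulVecLin.finrank_range_add_finrank_ker
  rw [Module.finrank_fin_fun] at hdim
  have hle : LinearMap.ker (1 - A).mulVecLin ≤ LinearMap.range (A ^ 3 + A ^ 4).mulVecLin := by
    intro x hx
    rw [LinearMap.mem_ker, Matrix.mulVecLin_apply, Matrix.sub_mulVec, Matrix.one_mulVec,
      sub_eq_zero] at hx
    have hA : A.mulVec x = x := hx.symm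
    have hp : ∀ k : ℕ, (A ^ k).mulVec x = x := by
      intro k
      induction k with
      | zero => simp
      | succ k ih => rw [pow_succ, ← Matrix.mulVec_mulVec, hA, ih]
    refine ⟨(2 : K)⁻¹ • x, ?_⟩
    rw [map_smul, Matrix.mulVecLin_apply, Matrix.add_mulVec, hp, hp, ← two_smul K x, smul_smul,
      inv_mul_cancel₀ h2, one_smul]
  have hiff : A ^ 3 = A ^ 5 ↔
      LinearMap.range (A ^ 3 + A ^ 4).mulVecLin ≤ LinearMap.ker (1 - A).mulVecLin := by
    rw [LinearMap.range_le_ker_iff, ← Matrix.mulVecLin_mul, hPQ, ← sub_eq_zero]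
    constructor
    · intro h
      rw [h, Matrix.mulVecLin_zero]
    · intro h
      apply Matrix.mulVec_injective
      funext x
      have := LinearMap.congr_fun h x
      simpa [Matrix.sub_mulVec] using this
  rw [hiff]
  unfold Matrix.rank
  constructor
  · intro h
    rw [le_antisymm h hle]
    exact hdim
  · intro h
    exact (Submodule.eq_of_le_of_finrank_eq hle (by omega)).ge
end

section
/- Let K be a field of characteristic different from 2, n ≥ 1, and A an n×n matrix over K. Then A³ = A⁵ if and only if rank(Iₙ + A) + rank(A³ − A⁴) = n. -/
theorem pow_three_eq_pow_five_iff_rank_one_add_add_rank_cube_sub_pow_four_eq_card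
    {K : Type*} [Field K] (hK : ringChar K ≠ 2) {n : ℕ} (hn : 1 ≤ n)
    (A : Matrix (Fin n) (Fin n) K) :
    A ^ 3 = A ^ 5 ↔ (1 + A).rank + (A ^ 3 - A ^ 4).rank = n := by
  have h2 : (2 : K) ≠ 0 := Ring.two_ne_zero hK
  have hPQ : (1 + A) * (A ^ 3 - A ^ 4) = A ^ 3 - A ^ 5 := by noncomm_ring
  have hle : LinearMap.ker (1 + A).mulVecLin ≤ LinearMap.range (A ^ 3 - A ^ 4).mulVecLin := by
    intro v hv
    have hv' : (1 + A).mulVec v = 0 := hv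
    have h1 : A.mulVec v = -v := by
      rw [Matrix.add_mulVec, Matrix.one_mulVec] at hv'
      exact (neg_eq_of_add_eq_zero_right hv').symm
    have h3 : (A ^ 3 - A ^ 4).mulVec v = (-2 : K) • v := by
      simp only [Matrix.sub_mulVec, pow_succ, pow_zero, one_mul, ← Matrix.mulVec_mulVec, h1,
        Matrix.mulVec_neg, neg_neg]
      module
    refine ⟨(-2 : K)⁻¹ • v, ?_⟩
    rw [map_smul, Matrix.mulVecLin_apply, h3, smul_smul,
      inv_mul_cancel₀ (neg_ne_zero.mpr h2), one_smul]
  have hrn := LinearMap.finrank_range_add_finrank_ker (1 + A).mulVecLin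
  rw [Module.finrank_fin_fun] at hrn
  have hP : (1 + A).rank = Module.finrank K (LinearMap.range (1 + A).mulVecLin) := rfl
  have hQ : (A ^ 3 - A ^ 4).rank =
    Module.finrank K (LinearMap.range (A ^ 3 - A ^ 4).mulVecLin) := rfl
  constructor
  · intro h
    have hge : LinearMap.range (A ^ 3 - A ^ 4).mulVecLin ≤ LinearMap.ker (1 + A).mulVecLin := by
      rintro _ ⟨v, rfl⟩
      simp only [LinearMap.mem_ker, Matrix.mulVecLin_apply, Matrix.mulVec_mulVec]
      rw [hPQ, h, sub_self, Matrix.zero_mulVec]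
    rw [hP, hQ, ← le_antisymm hle hge]
    exact hrn
  · intro h
    have heq := Submodule.eq_of_le_of_finrank_eq hle (by omega)
    rw [← sub_eq_zero, ← hPQ]
    apply Matrix.mulVec_injective
    funext v
    have : (A ^ 3 - A ^ 4).mulVecLin v ∈ LinearMap.ker (1 + A).mulVecLin := by
      rw [heq]; exact ⟨v, rfl⟩
    simpa only [LinearMap.mem_ker, Matrix.mulVecLin_apply, Matrix.mulVec_mulVec,
      Matrix.zero_mulVec] using this
end

section
/- Let K be a field of characteristic different from 2, n ≥ 1, and A an n×n matrix over K. Then A³ = A⁵ if and only if rank A³ + rank(Iₙ − A) + rank(Iₙ + A) = 2n. -/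
open Polynomial in
theorem finrank_ker_aeval_mul_aux {K V : Type*} [Field K] [AddCommGroup V] [Module K V]
    [FiniteDimensional K V] (f : V →ₗ[K] V) {p q : K[X]} (h : IsCoprime p q) :
    Module.finrank K (LinearMap.ker (aeval f (p * q))) =
      Module.finrank K (LinearMap.ker (aeval f p)) +
      Module.finrank K (LinearMap.ker (aeval f q)) := by
  have h1 := Submodule.finrank_sup_add_finrank_inf_eq
    (LinearMap.ker (aeval f p)) (LinearMap.ker (aeval f q))
  rw [sup_ker_aeval_eq_ker_aeval_mul_of_coprime f h,
    (disjoint_ker_aeval_of_isCoprime f h).eq_bot] at h1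
  simpa using h1

open Polynomial in
theorem rank_add_finrank_ker_aux {K : Type*} [Field K] {n : ℕ}
    (A : Matrix (Fin n) (Fin n) K) (p : K[X]) :
    (aeval A p).rank +
      Module.finrank K (LinearMap.ker (aeval (Matrix.toLinAlgEquiv' A) p)) = n := by
  have h1 : aeval (Matrix.toLinAlgEquiv' A) p = Matrix.toLinAlgEquiv' (aeval A p) :=
    Polynomial.aeval_algHom_apply (Matrix.toLinAlgEquiv' (R := K) (n := Fin n)).toAlgHom A p
  have h2 := LinearMap.finrank_range_add_finrank_ker (Matrix.toLinAlgEquiv' (aeval A p))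
  rw [h1]
  rw [Module.finrank_fin_fun] at h2
  exact h2

open Polynomial in
theorem pow_three_eq_pow_five_iff_rank_cube_add_rank_one_sub_add_rank_one_add_eq_two_mul
    {K : Type*} [Field K] (hK : ringChar K ≠ 2) {n : ℕ} (hn : 1 ≤ n)
    (A : Matrix (Fin n) (Fin n) K) :
    A ^ 3 = A ^ 5 ↔ (A ^ 3).rank + (1 - A).rank + (1 + A).rank = 2 * n := by
  have h2 : (2 : K) ≠ 0 := Ring.two_ne_zero hK
  have c1 : IsCoprime (X ^ 3 : K[X]) (1 - X) :=
    IsCoprime.pow_left ⟨1, 1, by ring⟩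
  have c2 : IsCoprime (X ^ 3 : K[X]) (1 + X) :=
    IsCoprime.pow_left ⟨-1, 1, by ring⟩
  have c3 : IsCoprime (1 - X : K[X]) (1 + X) := by
    refine ⟨C (2⁻¹), C (2⁻¹), ?_⟩
    have : C (2⁻¹ : K) * 2 = 1 := by
      rw [← C_ofNat, ← C_mul, inv_mul_cancel₀ h2, C_1]
    linear_combination this
  have e1 := finrank_ker_aeval_mul_aux (Matrix.toLinAlgEquiv' A) c1
  have e2 := finrank_ker_aeval_mul_aux (Matrix.toLinAlgEquiv' A) (c2.mul_left c3)
  have r1 := rank_add_finrank_ker_aux A (X ^ 3)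
  have r2 := rank_add_finrank_ker_aux A (1 - X)
  have r3 := rank_add_finrank_ker_aux A (1 + X)
  have r4 := rank_add_finrank_ker_aux A (X ^ 3 * (1 - X) * (1 + X))
  have a1 : aeval A (X ^ 3 : K[X]) = A ^ 3 := by simp
  have a2 : aeval A (1 - X : K[X]) = 1 - A := by simp
  have a3 : aeval A (1 + X : K[X]) = 1 + A := by simp
  have a4 : aeval A (X ^ 3 * (1 - X) * (1 + X) : K[X]) = A ^ 3 - A ^ 5 := by
    rw [show (X ^ 3 * (1 - X) * (1 + X) : K[X]) = X ^ 3 - X ^ 5 by ring]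
    simp
  rw [a1] at r1
  rw [a2] at r2
  rw [a3] at r3
  rw [a4] at r4
  have hz : A ^ 3 = A ^ 5 ↔ (A ^ 3 - A ^ 5).rank = 0 := by
    rw [← sub_eq_zero]
    constructor
    · intro h
      rw [h, Matrix.rank_zero]
    · intro h
      rw [Matrix.rank, Submodule.finrank_eq_zero, LinearMap.range_eq_bot] at h
      exact Matrix.toLin'.injective (by simpa [Matrix.toLin'_apply'] using h)
  rw [hz]
  omega
end

section
/- Let K be a field of characteristic different from 2, n ≥ 1, and A an n×n matrix over K. Then A³ = A⁵ if and only if rank(A − A²) + rank(A³ + A⁴) = rank A. -/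
theorem rank_aux {K : Type*} [Field K] (hK : (2 : K) ≠ 0) {n : ℕ}
    (A : Matrix (Fin n) (Fin n) K) :
    (A - A ^ 2).rank + (A ^ 3 + A ^ 4).rank = A.rank + (A ^ 3 - A ^ 5).rank := by
  have hsup : LinearMap.range (A - A ^ 2).mulVecLin ⊔ LinearMap.range (A ^ 3 + A ^ 4).mulVecLin
      = LinearMap.range A.mulVecLin := by
    apply le_antisymm
    · apply sup_le
      · rintro _ ⟨x, rfl⟩
        refine ⟨(1 - A).mulVec x, ?_⟩
        simp only [Matrix.mulVecLin_apply, Matrix.mulVec_mulVec]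
        congr 1
        noncomm_ring
      · rintro _ ⟨x, rfl⟩
        refine ⟨(A ^ 2 + A ^ 3).mulVec x, ?_⟩
        simp only [Matrix.mulVecLin_apply, Matrix.mulVec_mulVec]
        congr 1
        noncomm_ring
    · rintro _ ⟨x, rfl⟩
      rw [Submodule.mem_sup]
      refine ⟨_, ⟨(A ^ 2 + A + A + 1 + 1).mulVec ((2 : K)⁻¹ • x), rfl⟩, _,
        ⟨(2 : K)⁻¹ • x, rfl⟩, ?_⟩
      simp only [Matrix.mulVecLin_apply, Matrix.mulVec_mulVec]
      rw [← Matrix.add_mulVec]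
      have h : (A - A ^ 2) * (A ^ 2 + A + A + 1 + 1) + (A ^ 3 + A ^ 4) = A + A := by
        noncomm_ring
      rw [h, Matrix.add_mulVec, ← two_smul K, Matrix.mulVec_smul, smul_smul,
        mul_inv_cancel₀ hK, one_smul]
  have hinf : LinearMap.range (A - A ^ 2).mulVecLin ⊓ LinearMap.range (A ^ 3 + A ^ 4).mulVecLin
      = LinearMap.range (A ^ 3 - A ^ 5).mulVecLin := by
    apply le_antisymm
    · rintro y ⟨⟨a, ha⟩, ⟨b, hb⟩⟩
      simp only [Matrix.mulVecLin_apply] at ha hb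
      refine ⟨(2 : K)⁻¹ • ((A ^ 2 + A + A + 1 + 1).mulVec b + a), ?_⟩
      have h1 : (A ^ 3 - A ^ 5).mulVec a = (A ^ 2 + A ^ 3).mulVec y := by
        rw [← ha, Matrix.mulVec_mulVec]
        congr 1
        noncomm_ring
      have h2 : (A ^ 3 - A ^ 5).mulVec ((A ^ 2 + A + A + 1 + 1).mulVec b)
          = ((A ^ 2 + A + A + 1 + 1) * (1 - A)).mulVec y := by
        rw [← hb, Matrix.mulVec_mulVec, Matrix.mulVec_mulVec]
        congr 1
        noncomm_ring
      have h : (A ^ 2 + A + A + 1 + 1) * (1 - A) + (A ^ 2 + A ^ 3) = 1 + 1 := by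
        noncomm_ring
      rw [Matrix.mulVecLin_apply, Matrix.mulVec_smul, Matrix.mulVec_add, h1, h2,
        ← Matrix.add_mulVec, h, Matrix.add_mulVec, Matrix.one_mulVec, ← two_smul K, smul_smul,
        inv_mul_cancel₀ hK, one_smul]
    · rintro _ ⟨x, rfl⟩
      refine ⟨⟨(A ^ 2 + A ^ 3).mulVec x, ?_⟩, ⟨(1 - A).mulVec x, ?_⟩⟩ <;>
      · simp only [Matrix.mulVecLin_apply, Matrix.mulVec_mulVec]
        congr 1
        noncomm_ring
  have := Submodule.finrank_sup_add_finrank_inf_eq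
    (LinearMap.range (A - A ^ 2).mulVecLin) (LinearMap.range (A ^ 3 + A ^ 4).mulVecLin)
  rw [hsup, hinf] at this
  exact this.symm

theorem pow_three_eq_pow_five_iff_rank_sub_sq_add_rank_cube_add_pow_four_eq_rank
    {K : Type*} [Field K] (hK : ringChar K ≠ 2) {n : ℕ} (hn : 1 ≤ n)
    (A : Matrix (Fin n) (Fin n) K) :
    A ^ 3 = A ^ 5 ↔ (A - A ^ 2).rank + (A ^ 3 + A ^ 4).rank = A.rank := by
  rw [rank_aux (Ring.two_ne_zero hK) A, Nat.add_eq_left]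
  constructor
  · intro h
    rw [h, sub_self, Matrix.rank_zero]
  · intro h
    rw [Matrix.rank, Submodule.finrank_eq_zero, LinearMap.range_eq_bot] at h
    rw [← sub_eq_zero]
    apply Matrix.mulVec_injective
    funext x
    have := LinearMap.congr_fun h x
    simpa [Matrix.sub_mulVec] using this
end

section
/- Let K be a field of characteristic different from 2, n ≥ 1, and A an n×n matrix over K. Then A³ = A⁵ if and only if rank(A + A²) + rank(A³ − A⁴) = rank A. -/
open Matrix in
theorem rank_aux_s17 {K : Type*} [Field K] {n : ℕ} (A P Q L U V : Matrix (Fin n) (Fin n) K)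
    (F G : Matrix (Fin n) (Fin n) K) (c : K) (hc : c ≠ 0)
    (hP : P = A * F) (hQ : Q = A * G) (h1 : P * U + Q * V = c • A)
    (h2 : U * F + V * G = c • 1) (h3 : U * F * Q = L * U) (h4 : V * G * P = L * V)
    (h5 : L = P * G) (h6 : L = Q * F) :
    P.rank + Q.rank = A.rank + L.rank := by
  have hsup : LinearMap.range P.mulVecLin ⊔ LinearMap.range Q.mulVecLin
      = LinearMap.range A.mulVecLin := by
    apply le_antisymm
    · apply sup_le
      · rintro _ ⟨x, rfl⟩
        exact ⟨F *ᵥ x, by simp [hP]⟩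
      · rintro _ ⟨x, rfl⟩
        exact ⟨G *ᵥ x, by simp [hQ]⟩
    · rintro _ ⟨x, rfl⟩
      have h := congrArg (fun M => M *ᵥ (c⁻¹ • x)) h1
      simp only [add_mulVec, smul_mulVec, mulVec_smul, smul_smul] at h
      rw [inv_mul_cancel₀ hc, one_smul, smul_add] at h
      rw [mulVecLin_apply, ← h]
      exact Submodule.add_mem_sup ⟨c⁻¹ • U *ᵥ x, by simp [mulVec_smul]⟩
        ⟨c⁻¹ • V *ᵥ x, by simp [mulVec_smul]⟩
  have hinf : LinearMap.range P.mulVecLin ⊓ LinearMap.range Q.mulVecLin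
      = LinearMap.range L.mulVecLin := by
    apply le_antisymm
    · rintro y ⟨⟨x, hx⟩, ⟨z, hz⟩⟩
      rw [mulVecLin_apply] at hx hz
      have h := congrArg (fun M => M *ᵥ y) h2
      simp only [add_mulVec, smul_mulVec, one_mulVec] at h
      have e1 : (U * F) *ᵥ y = L *ᵥ (U *ᵥ z) := by
        rw [← hz, mulVec_mulVec, h3, mulVec_mulVec]
      have e2 : (V * G) *ᵥ y = L *ᵥ (V *ᵥ x) := by
        rw [← hx, mulVec_mulVec, h4, mulVec_mulVec]
      refine ⟨c⁻¹ • (U *ᵥ z + V *ᵥ x), ?_⟩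
      rw [mulVecLin_apply, mulVec_smul, mulVec_add, ← e1, ← e2, h, smul_smul,
        inv_mul_cancel₀ hc, one_smul]
    · rintro _ ⟨x, rfl⟩
      exact ⟨⟨G *ᵥ x, by simp [h5]⟩, ⟨F *ᵥ x, by simp [h6]⟩⟩
  have h := Submodule.finrank_sup_add_finrank_inf_eq
    (LinearMap.range P.mulVecLin) (LinearMap.range Q.mulVecLin)
  rw [hsup, hinf] at h
  exact h.symm

theorem pow_three_eq_pow_five_iff_rank_add_sq_add_rank_cube_sub_pow_four_eq_rank
    {K : Type*} [Field K] (hK : ringChar K ≠ 2) {n : ℕ} (hn : 1 ≤ n)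
    (A : Matrix (Fin n) (Fin n) K) :
    A ^ 3 = A ^ 5 ↔ (A + A ^ 2).rank + (A ^ 3 - A ^ 4).rank = A.rank := by
  have h2 : (2 : K) ≠ 0 := Ring.two_ne_zero hK
  have key := rank_aux_s17 A (A + A ^ 2) (A ^ 3 - A ^ 4) (A ^ 3 - A ^ 5)
    (A ^ 2 - A - A + 1 + 1) 1 (1 + A) (A ^ 2 - A ^ 3) 2 h2
    (by noncomm_ring) (by noncomm_ring) (by rw [two_smul]; noncomm_ring)
    (by rw [two_smul]; noncomm_ring) (by noncomm_ring) (by noncomm_ring)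
    (by noncomm_ring) (by noncomm_ring)
  rw [key]
  constructor
  · intro h
    simp [h]
  · intro h
    have h0 : (A ^ 3 - A ^ 5).rank = 0 := by omega
    rw [Matrix.rank, Submodule.finrank_eq_zero, LinearMap.range_eq_bot] at h0
    have : A ^ 3 - A ^ 5 = 0 := by
      apply Matrix.mulVec_injective
      funext x
      simpa [Matrix.sub_mulVec] using LinearMap.congr_fun h0 x
    exact sub_eq_zero.mp this
end

section
/- Let K be a field of characteristic different from 2, n ≥ 1, and A an n×n matrix over K. Then A³ = A⁵ if and only if rank(A³ + A⁴) + rank(A³ − A⁴) = rank A³. -/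
theorem pow_three_eq_pow_five_iff_rank_cube_add_pow_four_add_rank_cube_sub_pow_four_eq_rank_cube
    {K : Type*} [Field K] (hK : ringChar K ≠ 2) {n : ℕ} (hn : 1 ≤ n)
    (A : Matrix (Fin n) (Fin n) K) :
    A ^ 3 = A ^ 5 ↔ (A ^ 3 + A ^ 4).rank + (A ^ 3 - A ^ 4).rank = (A ^ 3).rank := by
  have h2 : (2 : K) ≠ 0 := Ring.two_ne_zero hK
  have hle : ∀ B C : Matrix (Fin n) (Fin n) K,
      LinearMap.range (B * C).mulVecLin ≤ LinearMap.range B.mulVecLin := by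
    intro B C
    rw [Matrix.mulVecLin_mul]
    exact LinearMap.range_comp_le_range _ _
  have hP : A ^ 3 + A ^ 4 = A ^ 3 * (1 + A) := by noncomm_ring
  have hQ : A ^ 3 - A ^ 4 = A ^ 3 * (1 - A) := by noncomm_ring
  have hsup : LinearMap.range (A ^ 3 + A ^ 4).mulVecLin ⊔ LinearMap.range (A ^ 3 - A ^ 4).mulVecLin
      = LinearMap.range (A ^ 3).mulVecLin := by
    apply le_antisymm
    · refine sup_le ?_ ?_
      · rw [hP]; exact hle _ _
      · rw [hQ]; exact hle _ _
    · rintro _ ⟨v, rfl⟩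
      rw [Submodule.mem_sup]
      refine ⟨_, ⟨(2 : K)⁻¹ • v, rfl⟩, _, ⟨(2 : K)⁻¹ • v, rfl⟩, ?_⟩
      simp only [Matrix.mulVecLin_apply]
      rw [← Matrix.add_mulVec, add_add_sub_cancel, Matrix.add_mulVec, ← Matrix.mulVec_add,
        ← add_smul]
      congr 1
      rw [← two_mul, mul_inv_cancel₀ h2, one_smul]
  have hdim := Submodule.finrank_sup_add_finrank_inf_eq
    (LinearMap.range (A ^ 3 + A ^ 4).mulVecLin) (LinearMap.range (A ^ 3 - A ^ 4).mulVecLin)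
  rw [hsup] at hdim
  change (A ^ 3).rank + _ = (A ^ 3 + A ^ 4).rank + (A ^ 3 - A ^ 4).rank at hdim
  rw [← hdim, Nat.add_eq_left, Submodule.finrank_eq_zero, Submodule.eq_bot_iff]
  constructor
  · rintro h x ⟨⟨v, hv⟩, ⟨w, hw⟩⟩
    simp only [Matrix.mulVecLin_apply] at hv hw
    have h1 : A.mulVec x = x := by
      rw [← hv, Matrix.mulVec_mulVec]
      congr 1
      calc A * (A ^ 3 + A ^ 4) = A ^ 4 + A ^ 5 := by noncomm_ring
        _ = _ := by rw [← h, add_comm]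
    have h3 : A.mulVec x = -x := by
      rw [← hw, Matrix.mulVec_mulVec, ← Matrix.neg_mulVec]
      congr 1
      calc A * (A ^ 3 - A ^ 4) = A ^ 4 - A ^ 5 := by noncomm_ring
        _ = _ := by rw [← h, neg_sub]
    have h4 : (2 : K) • x = 0 := by
      rw [two_smul]; nth_rewrite 1 [← h1]; rw [h3, neg_add_cancel]
    exact (smul_eq_zero.mp h4).resolve_left h2
  · intro h
    rw [← sub_eq_zero]
    apply Matrix.mulVec_injective
    funext v
    rw [Matrix.zero_mulVec]
    refine h _ ⟨⟨(1 - A).mulVec v, ?_⟩, ⟨(1 + A).mulVec v, ?_⟩⟩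
    · rw [Matrix.mulVecLin_apply, Matrix.mulVec_mulVec]
      congr 1; noncomm_ring
    · rw [Matrix.mulVecLin_apply, Matrix.mulVec_mulVec]
      congr 1; noncomm_ring
end
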